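/- The mechanism A^{F*} satisfies reinforcement: for all preference profiles P (with n_P voters) and R (with n_R voters) such that A^{F*}_{n_P}(P) = A^{F*}_{n_R}(R), it holds that A^{F*}_{n_P + n_R}(P ∪ R) = A^{F*}_{n_P}(P), where P ∪ R denotes the concatenation of the two profiles and A^{F*}_k denotes the moving phantom mechanism for k voters defined by the phantom system F* for k voters. -/

import Mathlib

open Finset

/-- `p` is a budget division over `m` alternatives: entries in `[0,1]` summing to `1`. -/
def IsDivision {m : ℕ} (p : Fin m → ℝ) : Prop :=
  (∀ j, p j ∈ Set.Icc (0 : ℝ) 1) ∧ ∑ j, p j = 1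

/-- A valid preference profile: every voter reports a budget division. -/
def IsProfile {n m : ℕ} (P : Fin n → Fin m → ℝ) : Prop :=
  ∀ i, IsDivision (P i)

/-- The ℓ1 distance between two vectors. -/
noncomputable def l1 {m : ℕ} (x y : Fin m → ℝ) : ℝ := ∑ j, |x j - y j|

/-- Median of a list of odd length `2k+1`: its `(k+1)`-st smallest element. -/
noncomputable def medList (l : List ℝ) : ℝ :=
  ((Multiset.ofList l).sort (· ≤ ·)).getD ((l.length - 1) / 2) 0

/-- Coordinate-wise generalized median on alternative `j`, with phantoms `f k t` and
the voters' reports on alternative `j`. -/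
noncomputable def phMed {n m : ℕ} (f : Fin (n + 1) → ℝ → ℝ)
    (P : Fin n → Fin m → ℝ) (t : ℝ) (j : Fin m) : ℝ :=
  medList (List.ofFn (fun k => f k t) ++ List.ofFn (fun i => P i j))

/-- A phantom system for `n` voters: `n+1` continuous, weakly increasing functions
`[0,1] → [0,1]` with `f k 0 = 0`, `f k 1 = 1`, ordered `f 0 ≥ f 1 ≥ ⋯ ≥ f n`. -/
structure IsPhantomSystem (n : ℕ) (f : Fin (n + 1) → ℝ → ℝ) : Prop where
  cont : ∀ k, ContinuousOn (f k) (Set.Icc 0 1)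
  mono : ∀ k, MonotoneOn (f k) (Set.Icc 0 1)
  mem_Icc : ∀ k, ∀ t ∈ Set.Icc (0 : ℝ) 1, f k t ∈ Set.Icc (0 : ℝ) 1
  apply_zero : ∀ k, f k 0 = 0
  apply_one : ∀ k, f k 1 = 1
  ordered : ∀ t ∈ Set.Icc (0 : ℝ) 1, ∀ k l : Fin (n + 1), k ≤ l → f l t ≤ f k t

/-- The normalizing time `t*` at which the coordinate-wise medians sum to `1`. -/
noncomputable def tStar {n m : ℕ} (f : Fin (n + 1) → ℝ → ℝ)
    (P : Fin n → Fin m → ℝ) : ℝ :=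
  sInf {t | t ∈ Set.Icc (0 : ℝ) 1 ∧ ∑ j, phMed f P t j = 1}

/-- The moving phantom mechanism `A^F` defined by the phantom family `f`. -/
noncomputable def AMP {n m : ℕ} (f : Fin (n + 1) → ℝ → ℝ)
    (P : Fin n → Fin m → ℝ) : Fin m → ℝ :=
  fun j => phMed f P (tStar f P) j

/-- The independent-markets phantom system for `n` voters: `f k t = min (t(n-k)) 1`. -/
noncomputable def fIM (n : ℕ) : Fin (n + 1) → ℝ → ℝ :=
  fun k t => min (t * ((n : ℝ) - (k : ℝ))) 1

/-- The phantom system `F*` for `n` voters, in which the phantoms move to 1 one at a time. -/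
noncomputable def fStar (n : ℕ) : Fin (n + 1) → ℝ → ℝ :=
  fun k t => max 0 (min 1 (t * ((n : ℝ) + 1) - (k : ℝ)))

/-- The `j`-th standard unit vector in `ℝ^m`. -/
def unitVec (m : ℕ) (j : Fin m) : Fin m → ℝ := fun k => if k = j then 1 else 0

/-- Incentive compatibility under ℓ1 preferences. -/
def IncentiveCompatible {n m : ℕ} (A : (Fin n → Fin m → ℝ) → (Fin m → ℝ)) : Prop :=
  ∀ P : Fin n → Fin m → ℝ, IsProfile P → ∀ i : Fin n,
    ∀ ptrue pmis : Fin m → ℝ, IsDivision ptrue → IsDivision pmis →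
      l1 (A (Function.update P i ptrue)) ptrue ≤ l1 (A (Function.update P i pmis)) ptrue

/-- Anonymity: the output is invariant under permutations of the voters. -/
def Anonymous {n m : ℕ} (A : (Fin n → Fin m → ℝ) → (Fin m → ℝ)) : Prop :=
  ∀ P : Fin n → Fin m → ℝ, IsProfile P → ∀ σ : Equiv.Perm (Fin n), A (P ∘ σ) = A P

/-- Neutrality: permuting the alternatives in all reports permutes the output likewise. -/
def Neutral {n m : ℕ} (A : (Fin n → Fin m → ℝ) → (Fin m → ℝ)) : Prop :=
  ∀ P : Fin n → Fin m → ℝ, IsProfile P → ∀ σ : Equiv.Perm (Fin m),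
    A (fun i j => P i (σ j)) = fun j => A P (σ j)

/-- Proportionality: on single-minded profiles, alternative `j` gets `n_j / n`. -/
def Proportional {n m : ℕ} (A : (Fin n → Fin m → ℝ) → (Fin m → ℝ)) : Prop :=
  ∀ P : Fin n → Fin m → ℝ, (∀ i, ∃ j, P i = unitVec m j) →
    ∀ j, A P j = (Nat.card {i : Fin n // P i = unitVec m j} : ℝ) / (n : ℝ)

/-- Pareto optimality. -/
def ParetoOptimal {n m : ℕ} (A : (Fin n → Fin m → ℝ) → (Fin m → ℝ)) : Prop :=
  ∀ P : Fin n → Fin m → ℝ, IsProfile P → ∀ q : Fin m → ℝ, IsDivision q →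
    (∃ i, l1 q (P i) < l1 (A P) (P i)) → ∃ i, l1 (A P) (P i) < l1 q (P i)

/-- A mechanism is valid if it maps profiles to budget divisions. -/
def ValidMech {n m : ℕ} (A : (Fin n → Fin m → ℝ) → (Fin m → ℝ)) : Prop :=
  ∀ P, IsProfile P → IsDivision (A P)

/-- `q` maximizes (utilitarian) social welfare for `P`, i.e. minimizes total ℓ1 distance. -/
def MaximizesWelfare {n m : ℕ} (P : Fin n → Fin m → ℝ) (q : Fin m → ℝ) : Prop :=
  IsDivision q ∧ ∀ q' : Fin m → ℝ, IsDivision q' → ∑ i, l1 (P i) q ≤ ∑ i, l1 (P i) q'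

/-- The `k`-th largest entry of `v` (1-indexed); `0` when `k > n`. -/
noncomputable def kthLargest {n : ℕ} (v : Fin n → ℝ) (k : ℕ) : ℝ :=
  (((Multiset.ofList (List.ofFn v)).sort (· ≤ ·)).reverse).getD (k - 1) 0

lemma aux_sorted_count (p : ℝ → Prop) [DecidablePred p] (hp : ∀ a b, a ≤ b → p b → p a) :
    ∀ (s : List ℝ), s.Pairwise (· ≤ ·) → ∀ i, i < s.length →
      (p (s.getD i 0) ↔ i + 1 ≤ s.countP (fun x => decide (p x))) := by
  intro s
  induction s with
  | nil => intro _ i hi; simp at hi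
  | cons a s ih =>
    intro hs i hi
    rw [List.pairwise_cons] at hs
    obtain ⟨h1, h2⟩ := hs
    by_cases ha : p a
    · rw [List.countP_cons_of_pos (by simpa using ha)]
      cases i with
      | zero => simp [ha]
      | succ i =>
        have := ih h2 i (by simpa using hi)
        rw [List.getD_cons_succ, this]
        omega
    · rw [List.countP_cons_of_neg (by simpa using ha)]
      have hz : s.countP (fun x => decide (p x)) = 0 := by
        rw [List.countP_eq_zero]
        intro b hb
        simpa using fun h => ha (hp a b (h1 b hb) h)
      rw [hz]
      constructor
      · intro h
        exfalso
        cases i with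
        | zero => exact ha (by simpa using h)
        | succ i =>
          have hi' : i < s.length := by simpa using hi
          rw [List.getD_cons_succ, List.getD_eq_getElem _ _ hi'] at h
          exact ha (hp _ _ (h1 _ (List.getElem_mem hi')) h)
      · intro h; omega

lemma aux_med (p : ℝ → Prop) [DecidablePred p] (hp : ∀ a b, a ≤ b → p b → p a)
    (n : ℕ) (l : List ℝ) (hl : l.length = 2 * n + 1) :
    p (medList l) ↔ n + 1 ≤ l.countP (fun x => decide (p x)) := by
  unfold medList
  have hperm : ((Multiset.ofList l).sort (· ≤ ·)).Perm l := by
    rw [← Multiset.coe_eq_coe, Multiset.sort_eq]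
  have hn : (l.length - 1) / 2 = n := by omega
  rw [hn, aux_sorted_count p hp _ (Multiset.pairwise_sort _ _) n
    (by rw [hperm.length_eq]; omega), hperm.countP_eq]

lemma aux_countP_ofFn (p : ℝ → Prop) [DecidablePred p] {n : ℕ} (f : Fin n → ℝ) :
    (List.ofFn f).countP (fun x => decide (p x)) = #{i | p (f i)} := by
  rw [List.ofFn_eq_map, List.countP_map, List.countP_eq_length_filter]
  rfl

lemma aux_phMed (p : ℝ → Prop) [DecidablePred p] (hp : ∀ a b, a ≤ b → p b → p a)
    {n m : ℕ} (f : Fin (n + 1) → ℝ → ℝ) (P : Fin n → Fin m → ℝ) (t : ℝ) (j : Fin m) :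
    p (phMed f P t j) ↔ n + 1 ≤ #{k | p (f k t)} + #{i | p (P i j)} := by
  unfold phMed
  rw [aux_med p hp n _ (by simp; omega), List.countP_append, aux_countP_ofFn, aux_countP_ofFn]

lemma aux_le {n m : ℕ} (f : Fin (n + 1) → ℝ → ℝ) (P : Fin n → Fin m → ℝ) (t : ℝ) (j : Fin m)
    (c : ℝ) : phMed f P t j ≤ c ↔ n + 1 ≤ #{k | f k t ≤ c} + #{i | P i j ≤ c} :=
  aux_phMed (· ≤ c) (fun _ _ h h' => h.trans h') f P t j

lemma aux_lt {n m : ℕ} (f : Fin (n + 1) → ℝ → ℝ) (P : Fin n → Fin m → ℝ) (t : ℝ) (j : Fin m)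
    (c : ℝ) : phMed f P t j < c ↔ n + 1 ≤ #{k | f k t < c} + #{i | P i j < c} :=
  aux_phMed (· < c) (fun _ _ h h' => h.trans_lt h') f P t j

/-- comparison -/
lemma aux_cmp {n m : ℕ} (f : Fin (n + 1) → ℝ → ℝ) (P : Fin n → Fin m → ℝ) (t t' : ℝ) (j : Fin m)
    (e : ℝ) (he : 0 ≤ e) (h : ∀ k, f k t ≤ f k t' + e) : phMed f P t j ≤ phMed f P t' j + e := by
  rw [aux_le]
  refine ((aux_le f P t' j _).1 le_rfl).trans (add_le_add (card_le_card ?_) (card_le_card ?_))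
  · intro k hk
    simp only [mem_filter, mem_univ, true_and] at hk ⊢
    linarith [h k]
  · intro k hk
    simp only [mem_filter, mem_univ, true_and] at hk ⊢
    linarith

lemma aux_fStar_mono (n : ℕ) (k : Fin (n + 1)) {t t' : ℝ} (h : t ≤ t') :
    fStar n k t ≤ fStar n k t' := by
  unfold fStar
  gcongr

lemma aux_fStar_lip (n : ℕ) (k : Fin (n + 1)) (t t' : ℝ) :
    fStar n k t ≤ fStar n k t' + ((n : ℝ) + 1) * |t - t'| := by
  have h0 : 0 ≤ ((n : ℝ) + 1) * |t - t'| := by positivity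
  have h1 : t * ((n : ℝ) + 1) - k ≤ t' * ((n : ℝ) + 1) - k + ((n : ℝ) + 1) * |t - t'| := by
    have : 0 ≤ ((n : ℝ) + 1) * (|t - t'| - (t - t')) :=
      mul_nonneg (by positivity) (by linarith [le_abs_self (t - t')])
    nlinarith
  unfold fStar
  generalize t * ((n : ℝ) + 1) - k = a at *
  generalize t' * ((n : ℝ) + 1) - k = b at *
  grind

lemma aux_cont {n m : ℕ} (P : Fin n → Fin m → ℝ) (j : Fin m) :
    Continuous (fun t => phMed (fStar n) P t j) := by
  have : LipschitzWith ((n : NNReal) + 1) (fun t => phMed (fStar n) P t j) := by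
    apply LipschitzWith.of_le_add_mul
    intro t t'
    rw [Real.dist_eq]
    push_cast
    exact aux_cmp _ _ _ _ _ _ (by positivity) (fun k => aux_fStar_lip n k t t')
  exact this.continuous

lemma aux_mono {n m : ℕ} (P : Fin n → Fin m → ℝ) (j : Fin m) {t t' : ℝ} (h : t ≤ t') :
    phMed (fStar n) P t j ≤ phMed (fStar n) P t' j := by
  have := aux_cmp (fStar n) P t t' j 0 le_rfl (fun k => by simpa using aux_fStar_mono n k h)
  simpa using this

lemma aux_le_of {n m : ℕ} (f : Fin (n + 1) → ℝ → ℝ) (P : Fin n → Fin m → ℝ) (t : ℝ) (j : Fin m)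
    (c : ℝ) (h : ∀ k, f k t ≤ c) : phMed f P t j ≤ c := by
  rw [aux_le, filter_true_of_mem (fun k _ => h k)]
  simp

lemma aux_ge_of {n m : ℕ} (f : Fin (n + 1) → ℝ → ℝ) (P : Fin n → Fin m → ℝ) (t : ℝ) (j : Fin m)
    (c : ℝ) (h : ∀ k, c ≤ f k t) : c ≤ phMed f P t j := by
  rw [← not_lt, aux_lt, filter_false_of_mem (fun k _ => not_lt.2 (h k))]
  have := card_le_univ (filter (fun i => P i j < c) univ)
  simp at this ⊢
  omega

lemma aux_mem {n m : ℕ} (P : Fin n → Fin m → ℝ) (t : ℝ) (j : Fin m) :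
    0 ≤ phMed (fStar n) P t j ∧ phMed (fStar n) P t j ≤ 1 :=
  ⟨aux_ge_of _ _ _ _ _ (fun k => by simp [fStar]),
    aux_le_of _ _ _ _ _ (fun k => by simp [fStar])⟩

lemma aux_tStar {n m : ℕ} (hm : 1 ≤ m) (P : Fin n → Fin m → ℝ) :
    tStar (fStar n) P ∈ {t | t ∈ Set.Icc (0 : ℝ) 1 ∧ ∑ j, phMed (fStar n) P t j = 1} := by
  have hc : Continuous (fun t => ∑ j, phMed (fStar n) P t j) :=
    continuous_finsetSum _ (fun j _ => aux_cont P j)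
  refine IsClosed.csInf_mem (isClosed_Icc.inter (isClosed_eq hc continuous_const)) ?_ ?_
  · have h0 : ∑ j, phMed (fStar n) P 0 j ≤ 1 := by
      have : ∀ j ∈ univ, phMed (fStar n) P 0 j ≤ (fun _ : Fin m => (0 : ℝ)) j := fun j _ =>
        aux_le_of _ _ _ _ _ (fun k => by simp [fStar])
      have := sum_le_sum this
      simp at this
      linarith
    have h1 : 1 ≤ ∑ j, phMed (fStar n) P 1 j := by
      have : ∀ j ∈ univ, (fun _ : Fin m => (1 : ℝ)) j ≤ phMed (fStar n) P 1 j := fun j _ =>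
        aux_ge_of _ _ _ _ _ (fun k => by
          have : (k : ℝ) ≤ n := by exact_mod_cast Nat.lt_succ_iff.1 k.2
          simp only [fStar]
          rw [min_eq_left (by linarith)]
          simp)
      have := sum_le_sum this
      simp at this
      have hm' : (1 : ℝ) ≤ m := by exact_mod_cast hm
      linarith
    obtain ⟨t, ht, h⟩ := intermediate_value_Icc (zero_le_one' ℝ) hc.continuousOn ⟨h0, h1⟩
    exact ⟨t, ht, h⟩
  · exact ⟨0, fun t ht => ht.1.1⟩

/-- uniqueness of the outcome -/
lemma aux_unique {n m : ℕ} (hm : 1 ≤ m) (P : Fin n → Fin m → ℝ) (t : ℝ)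
    (ht : t ∈ Set.Icc (0 : ℝ) 1) (hs : ∑ j, phMed (fStar n) P t j = 1) :
    AMP (fStar n) P = fun j => phMed (fStar n) P t j := by
  have h := aux_tStar hm P
  have hle : tStar (fStar n) P ≤ t := csInf_le ⟨0, fun t ht => ht.1.1⟩ ⟨ht, hs⟩
  have := (sum_eq_sum_iff_of_le (fun j (_ : j ∈ univ) => aux_mono P j hle)).1 (h.2.trans hs.symm)
  funext j
  exact this j (mem_univ j)

lemma aux_char {n m : ℕ} (P : Fin n → Fin m → ℝ) (hP : IsProfile P) (t : ℝ) (j : Fin m)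
    (k : ℕ) (s : ℝ) (hk : k ≤ n) (h0 : 0 ≤ s) (h1 : s ≤ 1) (ht : t * ((n : ℝ) + 1) = k + s)
    (x : ℝ) (hx0 : 0 ≤ x) (hx1 : x ≤ 1) :
    phMed (fStar n) P t j = x ↔
      (#{i | P i j < x} + (if s < x then 1 else 0) ≤ k ∧
        k + 1 ≤ #{i | P i j ≤ x} + (if s ≤ x then 1 else 0)) := by
  have hf : ∀ i : Fin (n + 1), ((i : ℕ) < k → fStar n i t = 1) ∧
      ((i : ℕ) = k → fStar n i t = s) ∧ (k < (i : ℕ) → fStar n i t = 0) := by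
    intro i
    simp only [fStar, ht]
    refine ⟨fun h => ?_, fun h => ?_, fun h => ?_⟩
    · have : (i : ℝ) + 1 ≤ k := by exact_mod_cast h
      rw [min_eq_left (by linarith)]; simp
    · rw [h]; simp [h0, h1]
    · have : (k : ℝ) + 1 ≤ i := by exact_mod_cast h
      rw [max_eq_left]
      exact (min_le_right _ _).trans (by linarith)
  have hci : #(Ici (⟨k, by omega⟩ : Fin (n + 1))) = n + 1 - k := by rw [Fin.card_Ici]
  have hco : #(Ioi (⟨k, by omega⟩ : Fin (n + 1))) = n - k := by rw [Fin.card_Ioi]; simp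
  have hlt : 0 < x → #{i | fStar n i t < x} = n - k + (if s < x then 1 else 0) := by
    intro hx
    split_ifs with hs
    · rw [show n - k + 1 = n + 1 - k by omega, ← hci]
      congr 1
      ext i
      simp only [mem_filter, mem_univ, true_and, mem_Ici, Fin.le_def]
      have := hf i
      rcases lt_trichotomy (i : ℕ) k with h | h | h <;> grind
    · rw [add_zero, ← hco]
      congr 1
      ext i
      simp only [mem_filter, mem_univ, true_and, mem_Ioi, Fin.lt_def]
      have := hf i
      rcases lt_trichotomy (i : ℕ) k with h | h | h <;> grind
  have hle : x < 1 → #{i | fStar n i t ≤ x} = n - k + (if s ≤ x then 1 else 0) := by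
    intro hx
    split_ifs with hs
    · rw [show n - k + 1 = n + 1 - k by omega, ← hci]
      congr 1
      ext i
      simp only [mem_filter, mem_univ, true_and, mem_Ici, Fin.le_def]
      have := hf i
      rcases lt_trichotomy (i : ℕ) k with h | h | h <;> grind
    · rw [add_zero, ← hco]
      congr 1
      ext i
      simp only [mem_filter, mem_univ, true_and, mem_Ioi, Fin.lt_def]
      have := hf i
      rcases lt_trichotomy (i : ℕ) k with h | h | h <;> grind
  rw [eq_iff_le_not_lt, and_comm]
  refine and_congr ?_ ?_
  · rcases hx0.lt_or_eq with hx | hx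
    · rw [aux_lt, hlt hx]
      omega
    · have h2 : filter (fun i => P i j < x) univ = ∅ :=
        filter_false_of_mem (fun i _ => by rw [← hx]; exact not_lt.2 ((hP i).1 j).1)
      rw [h2, if_neg (by linarith)]
      have := (aux_mem P t j).1
      simp
      linarith
  · rcases hx1.lt_or_eq with hx | hx
    · rw [aux_le, hle hx]
      omega
    · have h2 : filter (fun i => P i j ≤ x) univ = univ :=
        filter_true_of_mem (fun i _ => by rw [hx]; exact ((hP i).1 j).2)
      rw [h2, if_pos (by linarith)]
      have := (aux_mem P t j).2
      simp [hk]
      linarith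

lemma aux_decomp (n : ℕ) (t : ℝ) (ht : t ∈ Set.Icc (0 : ℝ) 1) :
    ∃ k : ℕ, ∃ s : ℝ, k ≤ n ∧ 0 ≤ s ∧ s ≤ 1 ∧ t * ((n : ℝ) + 1) = k + s := by
  have hn : (0 : ℝ) ≤ n := by positivity
  have hu : t * ((n : ℝ) + 1) ≤ n + 1 := by nlinarith [ht.2]
  have hl : 0 ≤ t * ((n : ℝ) + 1) := mul_nonneg ht.1 (by linarith)
  by_cases h : t * ((n : ℝ) + 1) < n
  · refine ⟨⌊t * ((n : ℝ) + 1)⌋₊, t * ((n : ℝ) + 1) - ⌊t * ((n : ℝ) + 1)⌋₊, ?_, ?_, ?_, by ring⟩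
    · have := Nat.floor_le hl
      exact_mod_cast (this.trans h.le)
    · linarith [Nat.floor_le hl]
    · linarith [Nat.lt_floor_add_one (t * ((n : ℝ) + 1))]
  · exact ⟨n, t * ((n : ℝ) + 1) - n, le_rfl, by linarith, by linarith, by ring⟩

lemma aux_card_append (p : ℝ → Prop) [DecidablePred p] {n n' m : ℕ} (P : Fin n → Fin m → ℝ)
    (R : Fin n' → Fin m → ℝ) (j : Fin m) :
    #{i | p (Fin.append P R i j)} = #{i | p (P i j)} + #{i | p (R i j)} := by
  simp only [card_filter, Fin.sum_univ_add, Fin.append_left, Fin.append_right]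

/-- the mechanism `A^{F*}` satisfies reinforcement. -/
theorem fstar_reinforcement (m : ℕ) (hm : 2 ≤ m) (nP nR : ℕ) (hnP : 1 ≤ nP) (hnR : 1 ≤ nR)
    (P : Fin nP → Fin m → ℝ) (hP : IsProfile P)
    (R : Fin nR → Fin m → ℝ) (hR : IsProfile R)
    (heq : AMP (fStar nP) P = AMP (fStar nR) R) :
    AMP (fStar (nP + nR)) (Fin.append P R) = AMP (fStar nP) P := by
  have hm1 : 1 ≤ m := by omega
  obtain ⟨ht, hs⟩ := aux_tStar hm1 P
  obtain ⟨ht', -⟩ := aux_tStar hm1 R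
  obtain ⟨k, s, hk, hs0, hs1, hts⟩ := aux_decomp nP _ ht
  obtain ⟨l, s', hl, hs0', hs1', hts'⟩ := aux_decomp nR _ ht'
  have hPR : IsProfile (Fin.append P R) := by
    intro i
    induction i using Fin.addCases with
    | left i => rw [Fin.append_left]; exact hP i
    | right i => rw [Fin.append_right]; exact hR i
  have hd : (0 : ℝ) < ((nP + nR : ℕ) : ℝ) + 1 := by positivity
  have hkl : ((k + l : ℕ) : ℝ) ≤ ((nP + nR : ℕ) : ℝ) := by exact_mod_cast add_le_add hk hl
  set T : ℝ := (((k + l : ℕ) : ℝ) + s) / (((nP + nR : ℕ) : ℝ) + 1) with hT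
  have hTm : T ∈ Set.Icc (0 : ℝ) 1 :=
    ⟨by positivity, by rw [hT, div_le_one hd]; linarith⟩
  have hTe : T * (((nP + nR : ℕ) : ℝ) + 1) = ((k + l : ℕ) : ℝ) + s := by
    rw [hT]; field_simp
  have key : ∀ j, phMed (fStar (nP + nR)) (Fin.append P R) T j = AMP (fStar nP) P j := by
    intro j
    have hx : 0 ≤ AMP (fStar nP) P j ∧ AMP (fStar nP) P j ≤ 1 := aux_mem P _ j
    have h1 := (aux_char P hP _ j k s hk hs0 hs1 hts _ hx.1 hx.2).1 rfl
    have h2 := (aux_char R hR _ j l s' hl hs0' hs1' hts' _ hx.1 hx.2).1 (congrFun heq j).symm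
    rw [aux_char _ hPR T j (k + l) s (by omega) hs0 hs1 hTe _ hx.1 hx.2,
      aux_card_append (· < AMP (fStar nP) P j), aux_card_append (· ≤ AMP (fStar nP) P j)]
    have e1 : (0 : ℕ) ≤ if s' < AMP (fStar nP) P j then 1 else 0 := Nat.zero_le _
    have e2 : (if s' ≤ AMP (fStar nP) P j then 1 else 0) ≤ (1 : ℕ) := by split_ifs <;> simp
    omega
  rw [aux_unique hm1 (Fin.append P R) T hTm (by rw [sum_congr rfl (fun j _ => key j)]; exact hs)]
  exact funext key
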